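/- Let C be a connected subcomplex of a genus g triangulation T whose complementary dual D is connected, let f_0 be a boundary face of C, and suppose that every chordal edge incident to f_0 is separating, i.e., its dual edge is a bridge of D. Then every chordal edge incident to f_0 has both of its brins incident to boundary corners of f_0, and no two chordal edges d and e incident to f_0 are in crossing configuration: the brins d_1, d_2 of d and e_1, e_2 of e never appear in the cyclic order (..., d_1, ..., e_1, ..., d_2, ..., e_2, ...) in the complete list of brins of the boundary walk of f_0. Hence the boundary of f_0 together with its chordal edges forms a planar chord diagram. -/

import Mathlib

set_option linter.unusedSectionVars false

/- ----------------------------------------------------------------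
   A formalization of (topological) maps on closed orientable
   surfaces via combinatorial maps: a finite set of brins
   (half-edges/darts), a permutation `next` giving the clockwise
   order of the brins around their origin vertex, and a fixed-point
   free involution `opp` exchanging the two brins of each edge.
   Vertices are the orbits of `next`, edges the orbits of `opp`,
   faces the orbits of the facial-walk permutation
   `facePerm = opp ∘ next` (the follower of a brin, then its
   opposite).
   ---------------------------------------------------------------- -/

structure CombMap (D : Type) [Fintype D] [DecidableEq D] where
  next : Equiv.Perm D
  opp  : Equiv.Perm D
  opp_invol : ∀ d, opp (opp d) = d
  opp_ne : ∀ d, opp d ≠ d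

namespace CombMap

variable {D : Type} [Fintype D] [DecidableEq D]

/-- the facial-walk permutation: `b_{i+1}` is the opposite of the follower of `b_i` -/
def facePerm (M : CombMap D) : Equiv.Perm D := M.next.trans M.opp

/-- forward orbit of a dart under a function -/
def forb (f : D → D) (d : D) : Set D := {h | ∃ n : ℕ, f^[n] d = h}

/-- number of orbits of `f` met by the (f-invariant) set `s` -/
noncomputable def numOrbitsIn (f : D → D) (s : Set D) : ℕ :=
  ((fun d => forb f d) '' s).ncard

noncomputable def numVertices (M : CombMap D) : ℕ := numOrbitsIn (⇑M.next) Set.univ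
noncomputable def numEdges (M : CombMap D) : ℕ := numOrbitsIn (⇑M.opp) Set.univ
noncomputable def numFaces (M : CombMap D) : ℕ := numOrbitsIn (⇑M.facePerm) Set.univ

noncomputable def eulerChar (M : CombMap D) : ℤ :=
  (numVertices M : ℤ) - (numEdges M : ℤ) + (numFaces M : ℤ)

/-- the genus `g` of the surface on which `M` is embedded: Euler's relation `2 - 2g = |V|-|E|+|F|` -/
def HasGenus (M : CombMap D) (g : ℕ) : Prop := M.eulerChar = 2 - 2 * (g : ℤ)

def Connected (M : CombMap D) : Prop :=
  ∀ d d' : D, Relation.ReflTransGen (fun a b => b = M.next a ∨ b = M.opp a) d d'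

/-- the two darts have the same origin vertex -/
def sameVertex (M : CombMap D) (d d' : D) : Prop := d' ∈ forb (⇑M.next) d

def NoLoops (M : CombMap D) : Prop := ∀ d, ¬ M.sameVertex d (M.opp d)

def NoMultipleEdges (M : CombMap D) : Prop :=
  ∀ d d', M.sameVertex d d' → M.sameVertex (M.opp d) (M.opp d') → d' = d ∨ d' = M.opp d

/-- a triangulation of genus `g`: a connected simple map, all of whose faces have degree 3 -/
structure IsTriang (M : CombMap D) (g : ℕ) : Prop where
  conn : M.Connected
  noLoops : M.NoLoops
  noMult : M.NoMultipleEdges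
  deg3 : ∀ d, (⇑M.facePerm)^[3] d = d ∧ M.facePerm d ≠ d
  genus : M.HasGenus g

/- root face: marked by a dart `r`; the root face is the facial orbit of `r`,
   and the root vertices are `v_i = origin of facePerm^[i] r`, `i = 0,1,2`. -/

def rootDarts (M : CombMap D) (r : D) : Set D := forb (⇑M.facePerm) r

/-- the dart belongs to an edge of the root face (an "outer" edge) -/
def RootEdgeDart (M : CombMap D) (r : D) (h : D) : Prop :=
  h ∈ rootDarts M r ∨ M.opp h ∈ rootDarts M r

/-- the dart belongs to an inner edge -/
def InnerDart (M : CombMap D) (r : D) (h : D) : Prop := ¬ RootEdgeDart M r h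

/-- a dart whose origin is the root vertex `v_i` -/
def vDart (M : CombMap D) (r : D) (i : ℕ) : D := (⇑M.facePerm)^[i] r

/-- `v` (as a dart) is an inner vertex, i.e. not a vertex of the root face -/
def InnerVertex (M : CombMap D) (r : D) (v : D) : Prop :=
  ∀ h ∈ rootDarts M r, ¬ M.sameVertex h v

/- ------------------- subcomplexes ------------------- -/

/-- A subcomplex `C = (V',E',F')` of `M`, encoded by the sets of darts of its
vertices, edges and faces: `Vs` is `next`-closed (a union of vertex orbits),
`Es` is `opp`-closed, `Fs` is `facePerm`-closed, the edges of any chosen face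
belong to `C`, and the endpoints of any chosen edge belong to `C`. -/
structure Subcomplex (M : CombMap D) where
  Vs : Set D
  Es : Set D
  Fs : Set D
  vs_closed : ∀ d ∈ Vs, M.next d ∈ Vs
  es_closed : ∀ d ∈ Es, M.opp d ∈ Es
  fs_closed : ∀ d ∈ Fs, M.facePerm d ∈ Fs
  face_edges : ∀ d ∈ Fs, d ∈ Es
  edge_verts : ∀ d ∈ Es, d ∈ Vs

noncomputable def Subcomplex.eulerChar {M : CombMap D} (C : Subcomplex M) : ℤ :=
  (numOrbitsIn (⇑M.next) C.Vs : ℤ) - (numOrbitsIn (⇑M.opp) C.Es : ℤ)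
    + (numOrbitsIn (⇑M.facePerm) C.Fs : ℤ)

/-- first-return time (≥ 1) of the iteration of `f` into `s` -/
noncomputable def returnSteps (f : Equiv.Perm D) (s : Set D) (d : D) : ℕ :=
  sInf {k | 0 < k ∧ (⇑f)^[k] d ∈ s}

/-- first-return map of `f` into `s`: the follower of `d` within `s` -/
noncomputable def firstReturn (f : Equiv.Perm D) (s : Set D) (d : D) : D :=
  (⇑f)^[returnSteps f s d] d

/-- in the map induced on a set `E2` of darts (rotations given by first return of `next`),
the facial-walk successor: follower within `E2`, then opposite -/
noncomputable def gwalk (M : CombMap D) (E2 : Set D) (d : D) : D :=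
  M.opp (firstReturn M.next E2 d)

/-- number of facial walks of the subgraph spanned by the darts `E2` -/
noncomputable def graphFaces (M : CombMap D) (E2 : Set D) : ℕ :=
  numOrbitsIn (gwalk M E2) E2

def graphFaceOrbits (M : CombMap D) (E2 : Set D) : Set (Set D) :=
  {s | ∃ d ∈ E2, s = forb (gwalk M E2) d}

/-- the facial-walk successor on the boundary of a subcomplex -/
noncomputable def Subcomplex.bwalk {M : CombMap D} (C : Subcomplex M) : D → D :=
  gwalk M C.Es

/-- a boundary brin: a brin of `C` lying on a facial walk of `C` which does not
bound a face of `C` (for `Fs` a union of full face orbits these are the brins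
of `Es \ Fs`); it is identified with the boundary corner it starts -/
def Subcomplex.BoundaryBrin {M : CombMap D} (C : Subcomplex M) (d : D) : Prop :=
  d ∈ C.Es ∧ d ∉ C.Fs

/-- number of boundary faces of `C` (one disk attached to each boundary walk) -/
noncomputable def Subcomplex.numBoundaryFaces {M : CombMap D} (C : Subcomplex M) : ℕ :=
  numOrbitsIn C.bwalk (C.Es \ C.Fs)

/-- Euler characteristic of the map associated with `C` (disks attached) -/
noncomputable def Subcomplex.assocEulerChar {M : CombMap D} (C : Subcomplex M) : ℤ :=
  C.eulerChar + (C.numBoundaryFaces : ℤ)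

/-- the map associated with `C` has genus `g'` -/
def Subcomplex.assocHasGenus {M : CombMap D} (C : Subcomplex M) (g' : ℤ) : Prop :=
  C.assocEulerChar = 2 - 2 * g'

/-- the exterior brins incident to the boundary corner at the boundary brin `d`:
the brins of `M \ C` strictly between `d` and its follower within `C`,
in cw order around the origin of `d` -/
def Subcomplex.cornerExterior {M : CombMap D} (C : Subcomplex M) (d : D) : Set D :=
  {g | ∃ j, 0 < j ∧ j < returnSteps M.next C.Es d ∧ g = (⇑M.next)^[j] d}

/-- a chordal edge: an edge of `M \ C` whose two brins are exterior brins
of boundary corners of `C` -/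
def Subcomplex.Chordal {M : CombMap D} (C : Subcomplex M) (h : D) : Prop :=
  h ∉ C.Es ∧ M.opp h ∉ C.Es ∧
  (∃ d, C.BoundaryBrin d ∧ h ∈ C.cornerExterior d) ∧
  (∃ d, C.BoundaryBrin d ∧ M.opp h ∈ C.cornerExterior d)

/-- a free boundary corner: no exterior edge of the corner is chordal -/
def Subcomplex.FreeCorner {M : CombMap D} (C : Subcomplex M) (d : D) : Prop :=
  C.BoundaryBrin d ∧ ∀ g ∈ C.cornerExterior d, ¬ C.Chordal g

/-- connectivity (through vertices and edges of `C`, avoiding the edges of `A`) -/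
def Subcomplex.reachAvoiding {M : CombMap D} (C : Subcomplex M) (A : Set D) (a b : D) : Prop :=
  Relation.ReflTransGen (fun x y =>
    (x ∈ C.Vs ∧ y ∈ C.Vs ∧ M.sameVertex x y) ∨
    (x ∈ C.Es ∧ x ∉ A ∧ M.opp x ∉ A ∧ y = M.opp x)) a b

def Subcomplex.Conn {M : CombMap D} (C : Subcomplex M) : Prop :=
  ∀ a ∈ C.Vs, ∀ b ∈ C.Vs, C.reachAvoiding ∅ a b

/-- a bridge: an edge whose removal disconnects the subcomplex -/
def Subcomplex.Bridge {M : CombMap D} (C : Subcomplex M) (h : D) : Prop :=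
  h ∈ C.Es ∧ ¬ (∀ a ∈ C.Vs, ∀ b ∈ C.Vs, C.reachAvoiding {h, M.opp h} a b)

/-- two boundary corners lie on the same boundary walk (boundary face) of `C` -/
def Subcomplex.SameBoundaryFace {M : CombMap D} (C : Subcomplex M) (a b : D) : Prop :=
  b ∈ forb C.bwalk a ∨ a ∈ forb C.bwalk b

/- ------------------- duality ------------------- -/

/-- the dual map: same darts, vertices of the dual are the faces of `M`
(rotation given by the facial walks), and `opp` unchanged. Under this
encoding the dual brin `h*` of a brin `h` is `h` itself. -/
def dual (M : CombMap D) : CombMap D where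
  next := M.facePerm
  opp := M.opp
  opp_invol := M.opp_invol
  opp_ne := M.opp_ne

lemma perm_inv_mem (f : Equiv.Perm D) (s : Set D)
    (hs : ∀ d ∈ s, f d ∈ s) : ∀ d ∈ s, f.symm d ∈ s := by
  have hiter : ∀ n : ℕ, ∀ d ∈ s, (⇑f)^[n] d ∈ s := by
    intro n
    induction n with
    | zero => intro d hd; simpa using hd
    | succ n ih => intro d hd; rw [Function.iterate_succ_apply]; exact ih _ (hs d hd)
  intro d hd
  have hpos : 0 < orderOf f := orderOf_pos f
  have hfix : (⇑f)^[orderOf f] d = d := by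
    rw [← Equiv.Perm.coe_pow, pow_orderOf_eq_one]; rfl
  have h2 : (⇑f)^[orderOf f] d = f ((⇑f)^[orderOf f - 1] d) := by
    conv_lhs => rw [← Nat.sub_add_cancel hpos]
    rw [Function.iterate_succ_apply']
  have hkey : f.symm d = (⇑f)^[orderOf f - 1] d := by
    apply f.injective
    rw [Equiv.apply_symm_apply, ← h2, hfix]
  rw [hkey]
  exact hiter _ d hd

lemma dual_facePerm (M : CombMap D) (d : D) : (dual M).facePerm d = M.next d := by
  simp [dual, facePerm, Equiv.trans_apply, M.opp_invol]

/-- the complementary dual of a subcomplex `C` of `M`: the subcomplex of the dual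
map formed by the vertices dual to unchosen faces, edges dual to unchosen edges,
and faces dual to unchosen vertices -/
def Subcomplex.compDual {M : CombMap D} (C : Subcomplex M) : Subcomplex (dual M) where
  Vs := C.Fsᶜ
  Es := C.Esᶜ
  Fs := C.Vsᶜ
  vs_closed := by
    intro d hd hmem
    have hmem' : M.facePerm d ∈ C.Fs := hmem
    exact hd (by
      have := perm_inv_mem M.facePerm C.Fs C.fs_closed _ hmem'
      simpa using this)
  es_closed := by
    intro d hd hmem
    have hmem' : M.opp d ∈ C.Es := hmem
    exact hd (by
      have := perm_inv_mem M.opp C.Es C.es_closed _ hmem'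
      simpa using this)
  fs_closed := by
    intro d hd hmem
    rw [dual_facePerm] at hmem
    exact hd (by
      have := perm_inv_mem M.next C.Vs C.vs_closed _ hmem
      simpa using this)
  face_edges := by
    intro d hd hmem
    exact hd (C.edge_verts _ hmem)
  edge_verts := by
    intro d hd hmem
    exact hd (C.face_edges _ hmem)

/- ------------------- complete boundary walks ------------------- -/

open Classical in
/-- the successor along the complete list of brins of a boundary walk
(boundary brins interleaved with the exterior brins of each boundary corner) -/
noncomputable def cwalk (M : CombMap D) (E2 : Set D) (h : D) : D :=
  if M.next h ∈ E2 then M.opp (M.next h) else M.next h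

noncomputable def Subcomplex.completeWalk {M : CombMap D} (C : Subcomplex M) : D → D :=
  cwalk M C.Es

/-- brins appearing on some complete boundary walk of `C` -/
def Subcomplex.walkSupport {M : CombMap D} (C : Subcomplex M) : Set D :=
  {h | ∃ d, C.BoundaryBrin d ∧ h ∈ forb C.completeWalk d}

/-- the complete boundary walks of `C`, as sets of brins -/
def Subcomplex.boundaryOrbits {M : CombMap D} (C : Subcomplex M) : Set (Set D) :=
  {s | ∃ d, C.BoundaryBrin d ∧ s = forb C.completeWalk d}

noncomputable def Subcomplex.walkPeriod {M : CombMap D} (C : Subcomplex M) (d : D) : ℕ :=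
  sInf {n | 0 < n ∧ (C.completeWalk)^[n] d = d}

open Classical in
/-- the dual brin map of Lemma `boundary`: `φ(h) = h*` if `h ∈ C`,
`φ(h) = opposite(h*)` otherwise (recall `h* = h` in our encoding of the dual) -/
noncomputable def dphi (M : CombMap D) (C : Subcomplex M) (h : D) : D :=
  if h ∈ C.Es then h else M.opp h

/-- same edge (as darts) -/
def SameEdgeDart (M : CombMap D) (a b : D) : Prop := b = a ∨ b = M.opp a

/- ------------------- the traversal operations ------------------- -/

/-- the darts of the faces of `M \ C` incident to the boundary corner at `d`,
together with all darts on these faces -/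
def Subcomplex.cornerFaceDarts {M : CombMap D} (C : Subcomplex M) (d : D) : Set D :=
  {g | ∃ j, j < returnSteps M.next C.Es d ∧ g ∈ forb (⇑M.facePerm) ((⇑M.next)^[j] d)}

/-- the operation `conquer(b)` at a free boundary corner `b = d`: add to `C` all
exterior faces incident to `b`, together with their edges and vertices -/
def IsConquer {M : CombMap D} (C : Subcomplex M) (d : D) (C' : Subcomplex M) : Prop :=
  C.FreeCorner d ∧
  C'.Fs = C.Fs ∪ C.cornerFaceDarts d ∧
  C'.Es = C.Es ∪ C.cornerFaceDarts d ∪ (⇑M.opp) '' C.cornerFaceDarts d ∧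
  C'.Vs = C.Vs ∪ {g | ∃ h ∈ C'.Es, g ∈ forb (⇑M.next) h}

/-- adding a (split or merge) chordal edge `h` to `C` -/
def IsAddEdge {M : CombMap D} (C : Subcomplex M) (h : D) (C' : Subcomplex M) : Prop :=
  C'.Fs = C.Fs ∧ C'.Es = C.Es ∪ {h, M.opp h} ∧ C'.Vs = C.Vs

/-- a split edge: a non-separating chordal edge (its dual is not a bridge of the
complementary dual) whose two brins are incident to boundary corners lying in
the same boundary face of `C` -/
def Subcomplex.SplitEdge {M : CombMap D} (C : Subcomplex M) (h : D) : Prop :=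
  C.Chordal h ∧ ¬ C.compDual.Bridge h ∧
  ∀ d d', C.BoundaryBrin d → h ∈ C.cornerExterior d →
    C.BoundaryBrin d' → M.opp h ∈ C.cornerExterior d' → C.SameBoundaryFace d d'

/-- a merge edge: a chordal edge whose two brins are incident to boundary corners
lying in distinct boundary faces of `C` -/
def Subcomplex.MergeEdge {M : CombMap D} (C : Subcomplex M) (h : D) : Prop :=
  C.Chordal h ∧
  ∃ d d', C.BoundaryBrin d ∧ h ∈ C.cornerExterior d ∧
    C.BoundaryBrin d' ∧ M.opp h ∈ C.cornerExterior d' ∧ ¬ C.SameBoundaryFace d d'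

/-- the initial subcomplex: the root face together with its edges and vertices -/
def IsRootComplex (M : CombMap D) (r : D) (C : Subcomplex M) : Prop :=
  C.Fs = rootDarts M r ∧
  C.Es = rootDarts M r ∪ (⇑M.opp) '' rootDarts M r ∧
  C.Vs = {g | ∃ h ∈ C.Es, g ∈ forb (⇑M.next) h}

def IsFull {M : CombMap D} (C : Subcomplex M) : Prop :=
  C.Fs = Set.univ ∧ C.Es = Set.univ ∧ C.Vs = Set.univ

/-- one (uncolored) step of the traversal: a conquest, a split, or a merge -/
def PlainStep (M : CombMap D) (C C' : Subcomplex M) : Prop :=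
  (∃ d, IsConquer C d C') ∨ (∃ h, (C.SplitEdge h ∨ C.MergeEdge h) ∧ IsAddEdge C h C')

/-- a subcomplex reachable from the root face by traversal steps -/
def ExecReach (M : CombMap D) (r : D) (C : Subcomplex M) : Prop :=
  ∃ C0, IsRootComplex M r C0 ∧ Relation.ReflTransGen (PlainStep M) C0 C

/- ------------------- the colorient rule ------------------- -/

/-- the `colorient` rule at the free boundary corner `d` (with `d'` the follower
of `d` within `C`): the edge of `d` is oriented out of the corner vertex with
color 1, the edge of `d'` is oriented outward with color 0, and all exterior
edges of the corner are oriented toward the corner vertex with color 2 (on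
non-special inner edges the opposite dart records the same edge seen from the
other endpoint; each dart of a special edge records its own copy). -/
def ColorientEq (M : CombMap D) (r : D) (C : Subcomplex M) (d : D)
    (dir : D → Bool) (col : D → Fin 3) (special : Set D) : Prop :=
  (InnerDart M r d → dir d = true ∧ col d = 1 ∧
      (d ∉ special → dir (M.opp d) = false ∧ col (M.opp d) = 1)) ∧
  (InnerDart M r (firstReturn M.next C.Es d) →
      dir (firstReturn M.next C.Es d) = true ∧ col (firstReturn M.next C.Es d) = 0 ∧
      (firstReturn M.next C.Es d ∉ special →
        dir (M.opp (firstReturn M.next C.Es d)) = false ∧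
        col (M.opp (firstReturn M.next C.Es d)) = 0)) ∧
  (∀ j, 0 < j → j < returnSteps M.next C.Es d → InnerDart M r ((⇑M.next)^[j] d) →
      dir ((⇑M.next)^[j] d) = false ∧ col ((⇑M.next)^[j] d) = 2 ∧
      dir (M.opp ((⇑M.next)^[j] d)) = true ∧ col (M.opp ((⇑M.next)^[j] d)) = 2)

/-- one step of `ComputeSchnyderAnyGenus`, recording colors and orientations -/
def GStep (M : CombMap D) (r : D) (C C' : Subcomplex M)
    (dir : D → Bool) (col : D → Fin 3) (special : Set D) : Prop :=
  (∃ d, IsConquer C d C' ∧ ColorientEq M r C d dir col special) ∨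
  (∃ h ∈ special, (C.SplitEdge h ∨ C.MergeEdge h) ∧ IsAddEdge C h C')

/-- a complete execution of the traversal algorithm `ComputeSchnyderAnyGenus`
on `M` with root face at `r`, producing the orientation `dir`, the coloring
`col` and the set `special` of darts of the (split/merge) special edges -/
structure GExec (M : CombMap D) (r : D)
    (dir : D → Bool) (col : D → Fin 3) (special : Set D) where
  N : ℕ
  Cs : ℕ → Subcomplex M
  init : IsRootComplex M r (Cs 0)
  final : IsFull (Cs N)
  step : ∀ k < N, GStep M r (Cs k) (Cs (k + 1)) dir col special
  special_opp : ∀ h ∈ special, M.opp h ∈ special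
  special_added : ∀ h ∈ special, ∃ k < N, ∃ h',
      ((Cs k).SplitEdge h' ∨ (Cs k).MergeEdge h') ∧ IsAddEdge (Cs k) h' (Cs (k + 1)) ∧
      (h = h' ∨ h = M.opp h')

/-- an execution of the planar traversal algorithm (conquests only) -/
structure PlanarExec (M : CombMap D) (r : D) (dir : D → Bool) (col : D → Fin 3) where
  N : ℕ
  Cs : ℕ → Subcomplex M
  init : IsRootComplex M r (Cs 0)
  final : IsFull (Cs N)
  step : ∀ k < N, ∃ d, IsConquer (Cs k) d (Cs (k + 1)) ∧
      ColorientEq M r (Cs k) d dir col ∅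

/-- a boundary brin of the edge `{v₀,v₁}` (marking the boundary face `f₀`) -/
def RootBoundaryBrin (M : CombMap D) (r : D) (C : Subcomplex M) (d0 : D) : Prop :=
  C.BoundaryBrin d0 ∧ M.sameVertex (vDart M r 0) d0 ∧ M.sameVertex (vDart M r 1) (M.opp d0)

/-- the implementation of the traversal that always chooses an update-candidate
incident to the boundary face containing `{v₀,v₁}` and gives priority to free
boundary corners over split and merge edges -/
def PriorityRun {M : CombMap D} (r : D) {dir : D → Bool} {col : D → Fin 3}
    {special : Set D} (E : GExec M r dir col special) : Prop :=
  ∀ k < E.N,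
    (∀ d, IsConquer (E.Cs k) d (E.Cs (k + 1)) →
        ∃ d0, RootBoundaryBrin M r (E.Cs k) d0 ∧ (E.Cs k).SameBoundaryFace d0 d) ∧
    (∀ h, ((E.Cs k).SplitEdge h ∨ (E.Cs k).MergeEdge h) →
        IsAddEdge (E.Cs k) h (E.Cs (k + 1)) →
        (¬ ∃ d d0, RootBoundaryBrin M r (E.Cs k) d0 ∧ (E.Cs k).FreeCorner d ∧
            (E.Cs k).SameBoundaryFace d0 d) ∧
        (∃ d d0, RootBoundaryBrin M r (E.Cs k) d0 ∧ (E.Cs k).BoundaryBrin d ∧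
            (E.Cs k).SameBoundaryFace d0 d ∧
            (h ∈ (E.Cs k).cornerExterior d ∨ M.opp h ∈ (E.Cs k).cornerExterior d)))

/- ------------------- Schnyder woods ------------------- -/

/-- the word pattern `Seq(In 1), Out 0, Seq(In 2), Out 1, Seq(In 0)` on values
`(outgoing?, color)` read in ccw order -/
def SchnyderPattern (l : List (Bool × Fin 3)) : Prop :=
  ∃ a b c : ℕ, l = List.replicate a ((false : Bool), (1 : Fin 3)) ++
    [((true : Bool), (0 : Fin 3))] ++ List.replicate b ((false : Bool), (2 : Fin 3)) ++
    [((true : Bool), (1 : Fin 3))] ++ List.replicate c ((false : Bool), (0 : Fin 3))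

noncomputable def vdeg (M : CombMap D) (v : D) : ℕ := (forb (⇑M.next) v).ncard

/-- the ccw successor around the origin vertex -/
noncomputable def ccwSucc (M : CombMap D) : D → D := ⇑M.next.symm

/-- the darts strictly after `s` in ccw order around its origin, one full turn -/
noncomputable def ccwTail (M : CombMap D) (s : D) : List D :=
  (List.range (vdeg M s - 1)).map fun i => (ccwSucc M)^[i + 1] s

open Classical in
/-- the darts of the sector starting right after the delimiter `s` (in ccw order),
up to the next delimiter -/
noncomputable def sectorDarts (M : CombMap D) (P : D → Prop) (s : D) : List D :=
  (ccwTail M s).takeWhile fun g => decide (¬ P g)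

noncomputable def nextDelim (M : CombMap D) (P : D → Prop) (s : D) : D :=
  (ccwSucc M)^[(sectorDarts M P s).length + 1] s

open Classical in
/-- the sequence of values `(outgoing?, color)` of the inner edges of the sector
that follows the delimiter `s` in ccw order around the origin of `s`.  A special
edge is doubled into two copies enclosing a special face: the copy recorded on the
dart `g` itself appears at the end of the sector preceding the special face of `g`,
and the copy recorded on `M.opp g` (seen from the origin of `g`, hence with
direction flipped) appears at the beginning of the sector following it.  When
`excl2 = true` (local condition at an inner vertex), a copy which is the outgoing
edge of color 2 is excluded from its sector. -/
noncomputable def sectorVals (M : CombMap D) (r : D) (special : Set D)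
    (dir : D → Bool) (col : D → Fin 3) (P : D → Prop) (excl2 : Bool) (s : D) :
    List (Bool × Fin 3) :=
  (if s ∈ special ∧ ¬ (excl2 = true ∧ (!(dir (M.opp s)), col (M.opp s)) =
      ((true : Bool), (2 : Fin 3)))
    then [((!(dir (M.opp s))), col (M.opp s))] else []) ++
  ((sectorDarts M P s).filter fun g => decide (InnerDart M r g)).map
      (fun g => (dir g, col g)) ++
  (if nextDelim M P s ∈ special ∧ ¬ (excl2 = true ∧
      (dir (nextDelim M P s), col (nextDelim M P s)) = ((true : Bool), (2 : Fin 3)))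
    then [(dir (nextDelim M P s), col (nextDelim M P s))] else [])

/-- delimiters around an inner vertex: the special darts and the outgoing dart of
color 2 -/
def innerDelim (special : Set D) (dir : D → Bool) (col : D → Fin 3) (g : D) : Prop :=
  g ∈ special ∨ (dir g = true ∧ col g = 2)

/-- delimiters around the root vertex `v_i`: the special darts and the root-face
corner (at the root dart `vDart M r i`) -/
def rootDelim (M : CombMap D) (r : D) (special : Set D) (i : ℕ) (g : D) : Prop :=
  g ∈ special ∨ g = vDart M r i

/-- local condition at an inner vertex `v`: exactly one outgoing edge (occurrence)
of color 2, and every sector (maximal interval avoiding the special faces and this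
edge) reads `Seq(In 1), Out 0, Seq(In 2), Out 1, Seq(In 0)` in ccw order -/
def LocalVertexCond (M : CombMap D) (r : D) (special : Set D)
    (dir : D → Bool) (col : D → Fin 3) (v : D) : Prop :=
  (∃! gc : D × Bool, M.sameVertex v gc.1 ∧
      cond gc.2 (gc.1 ∈ special ∧ dir (M.opp gc.1) = false ∧ col (M.opp gc.1) = 2)
        (dir gc.1 = true ∧ col gc.1 = 2)) ∧
  ∀ s, M.sameVertex v s → innerDelim special dir col s →
    SchnyderPattern (sectorVals M r special dir col (innerDelim special dir col) true s)

/-- root-face condition at `v_i` (`i = 0` or `1`): all inner edges of the root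
sector are ingoing of color `i`, and every other sector reads
`Seq(In 1), Out 0, Seq(In 2), Out 1, Seq(In 0)` in ccw order -/
def RootVertexCond (M : CombMap D) (r : D) (special : Set D)
    (dir : D → Bool) (col : D → Fin 3) (i : Fin 3) : Prop :=
  (∀ p ∈ sectorVals M r special dir col (rootDelim M r special (i : ℕ)) false
      (vDart M r (i : ℕ)), p = ((false : Bool), i)) ∧
  (∀ s, M.sameVertex (vDart M r (i : ℕ)) s → s ∈ special →
      SchnyderPattern (sectorVals M r special dir col
        (rootDelim M r special (i : ℕ)) false s))

/-- a cut-graph: a spanning cellular subgraph with a unique face, i.e. a connected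
spanning subgraph whose complement on the surface is a single open disk -/
def IsCutGraph (M : CombMap D) (gT : ℕ) (E2 : Set D) : Prop :=
  (∀ h ∈ E2, M.opp h ∈ E2) ∧
  (∀ v : D, ∃ h ∈ E2, M.sameVertex v h) ∧
  (∀ a ∈ E2, ∀ b ∈ E2, Relation.ReflTransGen
      (fun x y => x ∈ E2 ∧ y ∈ E2 ∧ (M.sameVertex x y ∨ y = M.opp x)) a b) ∧
  graphFaces M E2 = 1 ∧
  ((M.numVertices : ℤ) - (numOrbitsIn (⇑M.opp) E2 : ℤ)) + 1 = 2 - 2 * (gT : ℤ)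

/-- the darts of the cut-graph `G₂`: the (non-special) edges of color 2, the two
root edges `{v₀,v₂}` and `{v₁,v₂}`, and the special edges (not doubled) -/
def G2darts (M : CombMap D) (r : D) (special : Set D) (col : D → Fin 3) : Set D :=
  {h | InnerDart M r h ∧ h ∉ special ∧ col h = 2} ∪ special ∪
  {h | RootEdgeDart M r h ∧ (M.sameVertex (vDart M r 2) h ∨
      M.sameVertex (vDart M r 2) (M.opp h))}

/-- the edges of color 2 form a tree spanning all vertices except `v₀` and `v₁`,
rooted at `v₂` with all edges directed toward `v₂` -/
def Tree2Cond (M : CombMap D) (r : D) (special : Set D)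
    (dir : D → Bool) (col : D → Fin 3) : Prop :=
  (∀ h, InnerDart M r h → h ∉ special → col h = 2 →
      ¬ M.sameVertex (vDart M r 0) h ∧ ¬ M.sameVertex (vDart M r 1) h) ∧
  (∀ v : D, ¬ M.sameVertex (vDart M r 0) v → ¬ M.sameVertex (vDart M r 1) v →
      ¬ M.sameVertex (vDart M r 2) v →
      ∃! h, M.sameVertex v h ∧ InnerDart M r h ∧ h ∉ special ∧ col h = 2 ∧
        dir h = true) ∧
  (∀ h, M.sameVertex (vDart M r 2) h →
      ¬ (InnerDart M r h ∧ h ∉ special ∧ col h = 2 ∧ dir h = true)) ∧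
  (∀ v : D, ¬ M.sameVertex (vDart M r 0) v → ¬ M.sameVertex (vDart M r 1) v →
      Relation.ReflTransGen (fun a b => ∃ h, M.sameVertex a h ∧ InnerDart M r h ∧
          h ∉ special ∧ col h = 2 ∧ dir h = true ∧ M.sameVertex b (M.opp h))
        v (vDart M r 2))

/-- a `g`-Schnyder wood of a genus-`gT` triangulation with root face at `r`:
the inner edges are partitioned into normal edges and special edges (set of
darts `special`, each special edge carrying two independently directed and
colored copies, recorded on its two darts), every edge is directed and colored
in `{0,1,2}`, subject to the root-face condition, the local condition for inner
vertices and the cut-graph condition -/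
structure IsGSchnyderWood (M : CombMap D) (r : D) (gT : ℕ)
    (special : Set D) (dir : D → Bool) (col : D → Fin 3) : Prop where
  special_opp : ∀ h ∈ special, M.opp h ∈ special
  special_inner : ∀ h ∈ special, InnerDart M r h
  consistent : ∀ h, InnerDart M r h → h ∉ special →
      dir (M.opp h) = !dir h ∧ col (M.opp h) = col h
  v2_nospecial : ∀ g, M.sameVertex (vDart M r 2) g → g ∉ special
  v2_in2 : ∀ g, M.sameVertex (vDart M r 2) g → InnerDart M r g →
      dir g = false ∧ col g = 2
  root0 : RootVertexCond M r special dir col 0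
  root1 : RootVertexCond M r special dir col 1
  local_inner : ∀ v, InnerVertex M r v → LocalVertexCond M r special dir col v
  tree2 : Tree2Cond M r special dir col
  cut : IsCutGraph M gT (G2darts M r special col)

/-- a Schnyder wood of a plane triangulation (Definition of Schnyder): an
orientation and coloring of the inner edges such that all inner edges incident
to `v_i` are ingoing of color `i`, and around each inner vertex the edges read,
in ccw order: `Out 2, Seq(In 1), Out 0, Seq(In 2), Out 1, Seq(In 0)` -/
structure IsPlanarSchnyderWood (M : CombMap D) (r : D)
    (dir : D → Bool) (col : D → Fin 3) : Prop where
  consistent : ∀ h, InnerDart M r h → dir (M.opp h) = !dir h ∧ col (M.opp h) = col h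
  root_cond : ∀ i : Fin 3, ∀ g, M.sameVertex (vDart M r (i : ℕ)) g →
      InnerDart M r g → dir g = false ∧ col g = i
  local_cond : ∀ v, InnerVertex M r v → LocalVertexCond M r ∅ dir col v

end CombMap

namespace CombMap

variable {D : Type} [Fintype D] [DecidableEq D]

lemma forb_trans {f : D → D} {a b c : D} (hab : b ∈ forb f a) (hbc : c ∈ forb f b) :
    c ∈ forb f a := by
  obtain ⟨m, rfl⟩ := hab
  obtain ⟨n, rfl⟩ := hbc
  exact ⟨n + m, Function.iterate_add_apply f n m a⟩

lemma forb_symm {f : D → D} (hf : Function.Injective f) {a b : D} (hab : b ∈ forb f a) :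
    a ∈ forb f b := by
  obtain ⟨n, rfl⟩ := hab
  obtain ⟨p, hp, hper⟩ := hf.mem_periodicPts a
  refine ⟨p * n - n, ?_⟩
  rw [← Function.iterate_add_apply, Nat.sub_add_cancel (Nat.le_mul_of_pos_left n hp)]
  exact hper.mul_const n

lemma cwalk_of_mem {M : CombMap D} {E : Set D} {x : D} (hx : M.next x ∈ E) :
    cwalk M E x = M.opp (M.next x) := if_pos hx

lemma cwalk_of_notMem {M : CombMap D} {E : Set D} {x : D} (hx : M.next x ∉ E) :
    cwalk M E x = M.next x := if_neg hx

lemma returnSteps_spec (f : Equiv.Perm D) {s : Set D} {d : D} (hd : d ∈ s) :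
    0 < returnSteps f s d ∧ (⇑f)^[returnSteps f s d] d ∈ s := by
  obtain ⟨p, hp, hper⟩ := f.injective.mem_periodicPts d
  exact Nat.sInf_mem (s := {k | 0 < k ∧ (⇑f)^[k] d ∈ s}) ⟨p, hp, by rwa [hper.eq]⟩

lemma iterate_notMem_of_lt_returnSteps {f : Equiv.Perm D} {s : Set D} {d : D} {j : ℕ}
    (hj : 0 < j) (hlt : j < returnSteps f s d) : (⇑f)^[j] d ∉ s :=
  fun h => Nat.notMem_of_lt_sInf hlt ⟨hj, h⟩

lemma cwalk_iterate_of_lt_returnSteps {M : CombMap D} {E : Set D} {d : D} (j : ℕ)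
    (hlt : j < returnSteps M.next E d) : (cwalk M E)^[j] d = (⇑M.next)^[j] d := by
  induction j with
  | zero => rfl
  | succ j ih =>
    have hnot := iterate_notMem_of_lt_returnSteps j.succ_pos hlt
    rw [Function.iterate_succ_apply'] at hnot
    rw [Function.iterate_succ_apply', Function.iterate_succ_apply', ih (by omega),
      cwalk_of_notMem hnot]

lemma cwalk_iterate_returnSteps {M : CombMap D} {E : Set D} {d : D} (hd : d ∈ E) :
    (cwalk M E)^[returnSteps M.next E d] d = gwalk M E d := by
  obtain ⟨hpos, hmem⟩ := returnSteps_spec M.next hd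
  obtain ⟨k, hk⟩ := Nat.exists_eq_succ_of_ne_zero hpos.ne'
  rw [gwalk, firstReturn]
  rw [hk, Function.iterate_succ_apply'] at hmem ⊢
  rw [Function.iterate_succ_apply', cwalk_iterate_of_lt_returnSteps k (by omega),
    cwalk_of_mem hmem]

namespace Subcomplex

variable {M : CombMap D} (C : Subcomplex M)

lemma facePerm_mem_Fs_iff {x : D} : M.facePerm x ∈ C.Fs ↔ x ∈ C.Fs :=
  ⟨fun h => by simpa using perm_inv_mem M.facePerm C.Fs C.fs_closed _ h, C.fs_closed x⟩

lemma completeWalk_injective : Function.Injective C.completeWalk := by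
  intro a b hab
  unfold completeWalk at hab
  by_cases ha : M.next a ∈ C.Es <;> by_cases hb : M.next b ∈ C.Es
  · rw [cwalk_of_mem ha, cwalk_of_mem hb] at hab
    exact M.next.injective (M.opp.injective hab)
  · rw [cwalk_of_mem ha, cwalk_of_notMem hb] at hab
    exact absurd (hab ▸ C.es_closed _ ha) hb
  · rw [cwalk_of_notMem ha, cwalk_of_mem hb] at hab
    exact absurd (hab ▸ C.es_closed _ hb) ha
  · rw [cwalk_of_notMem ha, cwalk_of_notMem hb] at hab
    exact M.next.injective hab

lemma next_eq_of_completeWalk_eq {x h : D} (hh : h ∉ C.Es) (hx : C.completeWalk x = h) :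
    M.next x = h := by
  unfold completeWalk at hx
  by_cases hmem : M.next x ∈ C.Es
  · rw [cwalk_of_mem hmem] at hx
    exact absurd (hx ▸ C.es_closed _ hmem) hh
  · rwa [cwalk_of_notMem hmem] at hx

lemma completeWalk_notMem_Fs {x : D} (hx : x ∉ C.Fs) : C.completeWalk x ∉ C.Fs := by
  unfold completeWalk
  by_cases h : M.next x ∈ C.Es
  · rw [cwalk_of_mem h]
    exact fun hm => hx (C.facePerm_mem_Fs_iff.1 hm)
  · rw [cwalk_of_notMem h]
    exact fun hm => h (C.face_edges _ hm)

lemma completeWalk_iterate_notMem_Fs {x : D} (hx : x ∉ C.Fs) (n : ℕ) :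
    C.completeWalk^[n] x ∉ C.Fs := by
  induction n with
  | zero => exact hx
  | succ n ih =>
    rw [Function.iterate_succ_apply']
    exact C.completeWalk_notMem_Fs ih

lemma bwalk_mem_Es {d : D} (hd : d ∈ C.Es) : C.bwalk d ∈ C.Es :=
  C.es_closed _ (returnSteps_spec M.next hd).2

lemma bwalk_mem_forb_completeWalk {d : D} (hd : d ∈ C.Es) :
    C.bwalk d ∈ forb C.completeWalk d :=
  ⟨_, cwalk_iterate_returnSteps hd⟩

/-- On the brins of `C`, the orbits of `bwalk` are the traces of those of `completeWalk`. -/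
lemma mem_forb_bwalk_iff {a b : D} (ha : a ∈ C.Es) (hb : b ∈ C.Es) :
    b ∈ forb C.bwalk a ↔ b ∈ forb C.completeWalk a := by
  constructor
  · rintro ⟨n, rfl⟩
    clear hb
    induction n generalizing a with
    | zero => exact ⟨0, rfl⟩
    | succ n ih => exact forb_trans (C.bwalk_mem_forb_completeWalk ha) (ih (C.bwalk_mem_Es ha))
  · rintro ⟨n, rfl⟩
    induction n using Nat.strong_induction_on generalizing a with
    | _ n ih =>
      rcases Nat.eq_zero_or_pos n with rfl | hn
      · exact ⟨0, rfl⟩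
      have hpos := (returnSteps_spec M.next ha).1
      rcases lt_or_ge n (returnSteps M.next C.Es a) with hlt | hge
      · refine absurd hb ?_
        rw [completeWalk, cwalk_iterate_of_lt_returnSteps n hlt]
        exact iterate_notMem_of_lt_returnSteps hn hlt
      · have hsplit : C.completeWalk^[n] a =
            C.completeWalk^[n - returnSteps M.next C.Es a] (C.bwalk a) := by
          conv_lhs => rw [← Nat.sub_add_cancel hge, Function.iterate_add_apply]
          rw [bwalk, ← cwalk_iterate_returnSteps ha, completeWalk]
        rw [hsplit] at hb ⊢
        exact forb_trans ⟨1, rfl⟩ (ih _ (by omega) (C.bwalk_mem_Es ha) hb)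

lemma sameBoundaryFace_iff {a b : D} (ha : a ∈ C.Es) (hb : b ∈ C.Es) :
    C.SameBoundaryFace a b ↔ b ∈ forb C.completeWalk a := by
  rw [SameBoundaryFace, C.mem_forb_bwalk_iff ha hb, C.mem_forb_bwalk_iff hb ha]
  exact ⟨fun h => h.elim id (forb_symm C.completeWalk_injective), Or.inl⟩

lemma mem_forb_completeWalk_of_mem_cornerExterior {d h : D} (hh : h ∈ C.cornerExterior d) :
    h ∈ forb C.completeWalk d := by
  obtain ⟨j, -, hlt, rfl⟩ := hh
  exact ⟨j, cwalk_iterate_of_lt_returnSteps j hlt⟩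

lemma reachAvoiding_symm {A : Set D} {a b : D} (h : C.reachAvoiding A a b) :
    C.reachAvoiding A b a := by
  induction h with
  | refl => exact Relation.ReflTransGen.refl
  | tail _ hxy ih =>
    refine Relation.ReflTransGen.head ?_ ih
    rcases hxy with ⟨hx, hy, hxy⟩ | ⟨hx, hxA, hoA, rfl⟩
    · exact Or.inl ⟨hy, hx, forb_symm M.next.injective hxy⟩
    · exact Or.inr ⟨C.es_closed _ hx, hoA, by rwa [M.opp_invol], (M.opp_invol _).symm⟩

/-- In a connected subcomplex, a bridge separates its two ends. -/
lemma Conn.not_reachAvoiding_of_bridge {C : Subcomplex M} (hC : C.Conn) {h : D}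
    (hh : C.Bridge h) : ¬ C.reachAvoiding {h, M.opp h} h (M.opp h) := by
  intro hr
  refine hh.2 fun a ha b hb => ?_
  have key : ∀ c, C.reachAvoiding ∅ a c → C.reachAvoiding {h, M.opp h} a c := by
    intro c hc
    induction hc with
    | refl => exact Relation.ReflTransGen.refl
    | @tail x y _ hxy ih =>
      refine Relation.ReflTransGen.trans ih ?_
      rcases hxy with hv | ⟨hx, -, -, rfl⟩
      · exact Relation.ReflTransGen.single (Or.inl hv)
      · by_cases hxh : x = h
        · rw [hxh]
          exact hr
        by_cases hxo : x = M.opp h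
        · rw [hxo, M.opp_invol]
          exact C.reachAvoiding_symm hr
        refine Relation.ReflTransGen.single (Or.inr ⟨hx, by simp [hxh, hxo], ?_, rfl⟩)
        rintro (heq | heq)
        · exact hxo (by rw [← heq, M.opp_invol])
        · exact hxh (M.opp.injective heq)
  exact key b (hC a ha b hb)

lemma compDual_reachAvoiding_opp {h e : D} (he : e ∉ C.Es) (h1 : e ≠ h) (h2 : e ≠ M.opp h) :
    C.compDual.reachAvoiding {h, M.opp h} e (M.opp e) := by
  refine Relation.ReflTransGen.single (Or.inr ⟨he, by simp [h1, h2], ?_, rfl⟩)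
  rintro (heq | heq)
  · exact h2 (by rw [← heq]; exact (M.opp_invol e).symm)
  · exact h1 (M.opp.injective heq)

lemma compDual_reachAvoiding_facePerm {A : Set D} {x : D} (hx : x ∉ C.Fs) :
    C.compDual.reachAvoiding A x (M.facePerm x) :=
  Relation.ReflTransGen.single
    (Or.inl ⟨hx, fun hm => hx (C.facePerm_mem_Fs_iff.1 hm), 1, rfl⟩)

/-- The complete walk only leaves a component of the complementary dual minus an edge
when it arrives at a brin of that edge. -/
lemma compDual_reachAvoiding_completeWalk {h x : D} (hx : x ∉ C.Fs)
    (h1 : C.completeWalk x ≠ h) (h2 : C.completeWalk x ≠ M.opp h) :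
    C.compDual.reachAvoiding {h, M.opp h} x (C.completeWalk x) := by
  have hface := C.compDual_reachAvoiding_facePerm (A := {h, M.opp h}) hx
  unfold completeWalk at h1 h2 ⊢
  by_cases hE : M.next x ∈ C.Es
  · rw [cwalk_of_mem hE]
    exact hface
  · rw [cwalk_of_notMem hE] at h1 h2 ⊢
    exact Relation.ReflTransGen.trans hface
      (C.compDual.reachAvoiding_symm (C.compDual_reachAvoiding_opp hE h1 h2))

lemma compDual_reachAvoiding_iterate {h x : D} (hx : x ∉ C.Fs) (i n : ℕ)
    (hav : ∀ k, i < k → k ≤ i + n →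
      C.completeWalk^[k] x ≠ h ∧ C.completeWalk^[k] x ≠ M.opp h) :
    C.compDual.reachAvoiding {h, M.opp h} (C.completeWalk^[i] x)
      (C.completeWalk^[i + n] x) := by
  induction n with
  | zero => exact Relation.ReflTransGen.refl
  | succ n ih =>
    refine Relation.ReflTransGen.trans (ih fun k hk hk' => hav k hk (by omega)) ?_
    obtain ⟨h1, h2⟩ := hav (i + n + 1) (by omega) le_rfl
    rw [Function.iterate_succ_apply'] at h1 h2
    rw [← Nat.add_assoc, Function.iterate_succ_apply']
    exact C.compDual_reachAvoiding_completeWalk (C.completeWalk_iterate_notMem_Fs hx _) h1 h2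

/-- A complete walk through one brin of a bridge of the complementary dual also goes
through the other brin. -/
lemma opp_mem_forb_completeWalk_of_bridge (hD : C.compDual.Conn) {h : D}
    (hh : C.compDual.Bridge h) : M.opp h ∈ forb C.completeWalk h := by
  by_contra hnot
  have hE : h ∉ C.Es := hh.1
  have hF : h ∉ C.Fs := fun hm => hE (C.face_edges _ hm)
  have hper := C.completeWalk_injective.mem_periodicPts h
  obtain ⟨p, hp⟩ := Nat.exists_eq_succ_of_ne_zero
    (Function.minimalPeriod_pos_of_mem_periodicPts hper).ne'
  have hret := Function.iterate_minimalPeriod (f := C.completeWalk) (x := h)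
  rw [hp, Function.iterate_succ_apply'] at hret
  have hreach := C.compDual_reachAvoiding_iterate (h := h) hF 0 p fun k hk hk' =>
    ⟨fun heq => Function.not_isPeriodicPt_of_pos_of_lt_minimalPeriod
      hk.ne' (by omega) heq, fun heq => hnot ⟨k, heq⟩⟩
  rw [Nat.zero_add] at hreach
  refine hD.not_reachAvoiding_of_bridge hh (Relation.ReflTransGen.trans hreach ?_)
  have hface := C.compDual_reachAvoiding_facePerm (A := {h, M.opp h})
    (C.completeWalk_iterate_notMem_Fs hF p)
  rwa [facePerm, Equiv.trans_apply, C.next_eq_of_completeWalk_eq hE hret] at hface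

lemma completeWalk_iterate_ne_of_lt_walkPeriod {d : D} {i j : ℕ} (hij : i < j)
    (hj : j < C.walkPeriod d) : C.completeWalk^[j] d ≠ C.completeWalk^[i] d := by
  intro heq
  have hle : C.walkPeriod d ≤ j - i :=
    Nat.sInf_le ⟨by omega, Function.iterate_cancel C.completeWalk_injective heq⟩
  omega

end Subcomplex

end CombMap

/- STATEMENT 10: Let C be a connected subcomplex of a genus g triangulation
with connected complementary dual D, let f_0 be a boundary face of C
(represented by a boundary brin d0 on its walk), and suppose every chordal edge
incident to f_0 is separating (its dual is a bridge of D).  Then every chordal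
edge incident to f_0 has both brins incident to boundary corners of f_0, and no
two chordal edges incident to f_0 are in crossing configuration on the complete
list of brins of the boundary walk of f_0 (so the boundary of f_0 with its
chordal edges forms a planar chord diagram). -/

open CombMap in
theorem separating_chords_form_planar_diagram
    {D : Type} [Fintype D] [DecidableEq D]
    (M : CombMap D) (g : ℕ) (hT : IsTriang M g)
    (C : Subcomplex M) (hC : C.Conn) (hD : C.compDual.Conn)
    (d0 : D) (hb : C.BoundaryBrin d0)
    (hsep : ∀ h, C.Chordal h →
      (∃ d, C.BoundaryBrin d ∧ C.SameBoundaryFace d0 d ∧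
        (h ∈ C.cornerExterior d ∨ M.opp h ∈ C.cornerExterior d)) →
      C.compDual.Bridge h) :
    -- both brins of each chordal edge incident to f0 lie on f0
    (∀ h, C.Chordal h →
      ∀ d, C.BoundaryBrin d → h ∈ C.cornerExterior d → C.SameBoundaryFace d0 d →
      ∀ d', C.BoundaryBrin d' → M.opp h ∈ C.cornerExterior d' →
        C.SameBoundaryFace d0 d') ∧
    -- no crossing configuration (..., d1, ..., e1, ..., d2, ..., e2, ...)
    ¬ ∃ n1 n2 n3 n4 : ℕ, n1 < n2 ∧ n2 < n3 ∧ n3 < n4 ∧ n4 < C.walkPeriod d0 ∧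
        C.Chordal ((C.completeWalk)^[n1] d0) ∧
        C.Chordal ((C.completeWalk)^[n2] d0) ∧
        (C.completeWalk)^[n3] d0 = M.opp ((C.completeWalk)^[n1] d0) ∧
        (C.completeWalk)^[n4] d0 = M.opp ((C.completeWalk)^[n2] d0) ∧
        ¬ SameEdgeDart M ((C.completeWalk)^[n1] d0) ((C.completeWalk)^[n2] d0) := by
  refine ⟨fun h hch d hd hhd hsame d' hd' hhd' => ?_, ?_⟩
  · have hbr := hsep h hch ⟨d, hd, hsame, Or.inl hhd⟩
    rw [C.sameBoundaryFace_iff hb.1 hd.1] at hsame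
    rw [C.sameBoundaryFace_iff hb.1 hd'.1]
    exact forb_trans hsame (forb_trans (C.mem_forb_completeWalk_of_mem_cornerExterior hhd)
      (forb_trans (C.opp_mem_forb_completeWalk_of_bridge hD hbr)
        (forb_symm C.completeWalk_injective
          (C.mem_forb_completeWalk_of_mem_cornerExterior hhd'))))
  · rintro ⟨n1, n2, n3, n4, h12, h23, h34, h4, hch1, hch2, hopp1, hopp2, hne⟩
    have hbr : C.compDual.Bridge (C.completeWalk^[n1] d0) := by
      obtain ⟨d, hd, hhd⟩ := hch1.2.2.1
      refine hsep _ hch1 ⟨d, hd, (C.sameBoundaryFace_iff hb.1 hd.1).2 ?_, Or.inl hhd⟩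
      exact forb_trans ⟨n1, rfl⟩ (forb_symm C.completeWalk_injective
        (C.mem_forb_completeWalk_of_mem_cornerExterior hhd))
    have hr12 := C.compDual_reachAvoiding_iterate (h := C.completeWalk^[n1] d0) hb.2 n1 (n2 - n1)
      fun k hk hk' => ⟨C.completeWalk_iterate_ne_of_lt_walkPeriod hk (by omega), by
        rw [← hopp1]
        exact (C.completeWalk_iterate_ne_of_lt_walkPeriod (by omega) (by omega)).symm⟩
    have hr34 := C.compDual_reachAvoiding_iterate (h := C.completeWalk^[n1] d0) hb.2 n3 (n4 - n3)
      fun k hk hk' => ⟨C.completeWalk_iterate_ne_of_lt_walkPeriod (by omega) (by omega), by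
        rw [← hopp1]
        exact C.completeWalk_iterate_ne_of_lt_walkPeriod (by omega) (by omega)⟩
    rw [Nat.add_sub_cancel' h12.le] at hr12
    rw [Nat.add_sub_cancel' h34.le, hopp1, hopp2] at hr34
    have hcross := C.compDual_reachAvoiding_opp (h := C.completeWalk^[n1] d0) hch2.1
      (fun heq => hne (Or.inl heq)) (fun heq => hne (Or.inr heq))
    exact hD.not_reachAvoiding_of_bridge hbr (Relation.ReflTransGen.trans hr12
      (Relation.ReflTransGen.trans hcross (C.compDual.reachAvoiding_symm hr34)))
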